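/- Let 𝕂 be a commutative semiring, O^𝕂 a satisfiable 𝕂-annotated ELHI⊥ ontology, C a basic concept, κ ∈ K, I a model of O^𝕂 and d ∈ Δ^I such that (d,κ) ∈ C^I. Then there exists a homomorphism g: I_{C,κ,O^𝕂} → I from the canonical model of C, κ and O^𝕂 to I such that g(d_C) = d. -/

import Mathlib

namespace DLProv

/-! ### Syntax of ELHI⊥ -/

/-- A role: a role name or an inverse role. Role names are natural numbers. -/
inductive DLRole : Type
  | name : ℕ → DLRole
  | inv : ℕ → DLRole
deriving DecidableEq

/-- The underlying role name of a role. -/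
def DLRole.base : DLRole → ℕ
  | .name R => R
  | .inv R => R

/-- The inverse of a role. -/
def DLRole.invr : DLRole → DLRole
  | .name R => .inv R
  | .inv R => .name R

/-- ELHI⊥ concepts (built from concept names, ⊤, ⊥, ⊓ and ∃P.C). -/
inductive DLConcept : Type
  | top : DLConcept
  | bot : DLConcept
  | atom : ℕ → DLConcept
  | inter : DLConcept → DLConcept → DLConcept
  | exis : DLRole → DLConcept → DLConcept
deriving DecidableEq

namespace DLConcept

/-- ELHI concepts: those not mentioning ⊥. -/
def botFree : DLConcept → Prop
  | top => True
  | bot => False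
  | atom _ => True
  | inter C D => C.botFree ∧ D.botFree
  | exis _ C => C.botFree

/-- Basic concepts: concept names and concepts of the form ∃P (= ∃P.⊤). -/
def isBasic (C : DLConcept) : Prop := (∃ A, C = atom A) ∨ ∃ P, C = exis P top

/-- Admissible right-hand sides of GCIs: ⊥, a concept name, or ∃P. -/
def isRHS (C : DLConcept) : Prop := C = bot ∨ (∃ A, C = atom A) ∨ ∃ P, C = exis P top

/-- A concept name or ⊤. -/
def isAtomic (C : DLConcept) : Prop := C = top ∨ ∃ A, C = atom A

/-- Concept names occurring in a concept. -/
def concNames : DLConcept → Finset ℕ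
  | top => ∅
  | bot => ∅
  | atom A => {A}
  | inter C D => C.concNames ∪ D.concNames
  | exis _ C => C.concNames

/-- Role names occurring in a concept. -/
def roleNames : DLConcept → Finset ℕ
  | top => ∅
  | bot => ∅
  | atom _ => ∅
  | inter C D => C.roleNames ∪ D.roleNames
  | exis P C => insert P.base C.roleNames

end DLConcept

/-- ELHI⊥ axioms: concept assertions A(a), role assertions R(a,b),
role inclusions P ⊑ Q, negative role inclusions P ⊓ Q ⊑ ⊥, and GCIs C ⊑ D. -/
inductive DLAxiom : Type
  | cassert : ℕ → ℕ → DLAxiom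
  | rassert : ℕ → ℕ → ℕ → DLAxiom
  | roleInc : DLRole → DLRole → DLAxiom
  | roleDisj : DLRole → DLRole → DLAxiom
  | gci : DLConcept → DLConcept → DLAxiom
deriving DecidableEq

namespace DLAxiom

/-- Well-formedness: the right-hand side of a GCI is ⊥, a concept name, or ∃P. -/
def wf : DLAxiom → Prop
  | gci _ D => D.isRHS
  | _ => True

def isAssertion : DLAxiom → Prop
  | cassert _ _ => True
  | rassert _ _ _ => True
  | _ => False

def concNames : DLAxiom → Finset ℕ
  | cassert A _ => {A}
  | rassert _ _ _ => ∅
  | roleInc _ _ => ∅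
  | roleDisj _ _ => ∅
  | gci C D => C.concNames ∪ D.concNames

def roleNames : DLAxiom → Finset ℕ
  | cassert _ _ => ∅
  | rassert R _ _ => {R}
  | roleInc P Q => {P.base, Q.base}
  | roleDisj P Q => {P.base, Q.base}
  | gci C D => C.roleNames ∪ D.roleNames

def indNames : DLAxiom → Finset ℕ
  | cassert _ a => {a}
  | rassert _ a b => {a, b}
  | _ => ∅

/-- ⊥ does not occur in the axiom. -/
def botFree : DLAxiom → Prop
  | cassert _ _ => True
  | rassert _ _ _ => True
  | roleInc _ _ => True
  | roleDisj _ _ => False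
  | gci C D => C.botFree ∧ D.botFree

/-- Normal form: every GCI is of one of the forms A₁ ⊓ A₂ ⊑ B, ∃P.A ⊑ B, or A ⊑ ∃P,
with A, A₁, A₂ ∈ N_C ∪ {⊤} and B ∈ N_C ∪ {⊥}. -/
def inNF : DLAxiom → Prop
  | gci C D =>
      (∃ C₁ C₂, C = .inter C₁ C₂ ∧ C₁.isAtomic ∧ C₂.isAtomic ∧ (D = .bot ∨ ∃ B, D = .atom B)) ∨
      (∃ P C', C = .exis P C' ∧ C'.isAtomic ∧ (D = .bot ∨ ∃ B, D = .atom B)) ∨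
      (C.isAtomic ∧ ∃ P, D = .exis P .top)
  | _ => True

end DLAxiom

/-! ### Annotated interpretations over a commutative semiring -/

/-- A 𝕂-annotated interpretation with domain `dom` inside the type `Δ`. -/
structure Interp (Δ : Type) (K : Type) where
  dom : Set Δ
  dom_nonempty : dom.Nonempty
  indiv : ℕ → Δ
  indiv_mem : ∀ a, indiv a ∈ dom
  conc : ℕ → Set (Δ × K)
  conc_mem : ∀ A p, p ∈ conc A → p.1 ∈ dom
  role : ℕ → Set (Δ × Δ × K)
  role_mem : ∀ R p, p ∈ role R → p.1 ∈ dom ∧ p.2.1 ∈ dom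

variable {Δ Δ' K : Type}

/-- Annotated extension of a role. -/
def DLRole.interp (I : Interp Δ K) : DLRole → Set (Δ × Δ × K)
  | .name R => I.role R
  | .inv R => {p | (p.2.1, p.1, p.2.2) ∈ I.role R}

/-- Annotated extension of a concept. -/
def DLConcept.interp [CommSemiring K] (I : Interp Δ K) : DLConcept → Set (Δ × K)
  | .top => {p | p.1 ∈ I.dom ∧ p.2 = 1}
  | .bot => ∅
  | .atom A => I.conc A
  | .inter C D => {p | ∃ d κ₁ κ₂, (d, κ₁) ∈ DLConcept.interp I C ∧
      (d, κ₂) ∈ DLConcept.interp I D ∧ p = (d, κ₁ * κ₂)}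
  | .exis P C => {p | ∃ d e κ₁ κ₂, (d, e, κ₁) ∈ DLRole.interp I P ∧
      (e, κ₂) ∈ DLConcept.interp I C ∧ p = (d, κ₁ * κ₂)}

/-- Satisfaction of an annotated axiom. -/
def Interp.satA [CommSemiring K] (I : Interp Δ K) : DLAxiom → K → Prop
  | .cassert A a, κ => (I.indiv a, κ) ∈ I.conc A
  | .rassert R a b, κ => (I.indiv a, I.indiv b, κ) ∈ I.role R
  | .roleInc P Q, κ => ∀ d e κ', (d, e, κ') ∈ P.interp I → (d, e, κ * κ') ∈ Q.interp I
  | .roleDisj P Q, _ => ∀ d e κ₁ κ₂, (d, e, κ₁) ∈ P.interp I → (d, e, κ₂) ∈ Q.interp I → False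
  | .gci C .bot, _ => C.interp I = ∅
  | .gci C D, κ => ∀ d κ', (d, κ') ∈ C.interp I → (d, κ * κ') ∈ D.interp I

/-! ### Conjunctive queries -/

inductive DLTerm : Type
  | var : ℕ → DLTerm
  | ind : ℕ → DLTerm
deriving DecidableEq

/-- Query atoms: A(t) with A ∈ N_C ∪ {⊤}, or R(t,t') with R ∈ N_R. -/
inductive QAtom : Type
  | top : DLTerm → QAtom
  | conc : ℕ → DLTerm → QAtom
  | role : ℕ → DLTerm → DLTerm → QAtom
deriving DecidableEq

/-- A (Boolean) conjunctive query: a conjunction of atoms, all variables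
existentially quantified. -/
abbrev BCQ := List QAtom

def Interp.tval (I : Interp Δ K) (π : ℕ → Δ) : DLTerm → Δ
  | .var v => π v
  | .ind a => I.indiv a

/-- A match of the extended version of an atom, assigning value `κ` to its
annotation variable. -/
def QAtom.holds [CommSemiring K] (I : Interp Δ K) (π : ℕ → Δ) : QAtom → K → Prop
  | .top t, κ => I.tval π t ∈ I.dom ∧ κ = 1
  | .conc A t, κ => (I.tval π t, κ) ∈ I.conc A
  | .role R t t', κ => (I.tval π t, I.tval π t', κ) ∈ I.role R

/-- `I` satisfies the annotated BCQ (q, κ): some match of the extended version of `q`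
gives κ as the product of the values of the annotation variables. -/
def Interp.satQ [CommSemiring K] (I : Interp Δ K) (q : BCQ) (κ : K) : Prop :=
  ∃ π : ℕ → Δ, (∀ v, π v ∈ I.dom) ∧
    ∃ κs : List K, List.Forall₂ (fun a k => QAtom.holds I π a k) q κs ∧ κs.prod = κ

/-- A statement: an axiom or a BCQ. -/
inductive DLStmt : Type
  | ax : DLAxiom → DLStmt
  | query : BCQ → DLStmt

def Interp.satS [CommSemiring K] (I : Interp Δ K) : DLStmt → K → Prop
  | .ax α, κ => I.satA α κ
  | .query q, κ => I.satQ q κ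

/-! ### Annotated ontologies, models and entailment -/

/-- The set of annotated axioms of the annotated ontology ⟨O, λ⟩. -/
def toAnn (O : Finset DLAxiom) (lam : DLAxiom → K) : Set (DLAxiom × K) :=
  {p | p.1 ∈ O ∧ p.2 = lam p.1}

def isModel [CommSemiring K] (I : Interp Δ K) (Ω : Set (DLAxiom × K)) : Prop :=
  ∀ p ∈ Ω, I.satA p.1 p.2

/-- Satisfiability of a set of annotated axioms. -/
def AnnSat [CommSemiring K] (Ω : Set (DLAxiom × K)) : Prop :=
  ∃ (Δ : Type) (I : Interp Δ K), isModel I Ω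

/-- Entailment of an annotated statement from a set of annotated axioms. -/
def Entails [CommSemiring K] (Ω : Set (DLAxiom × K)) (s : DLStmt) (κ : K) : Prop :=
  ∀ (Δ : Type) (I : Interp Δ K), isModel I Ω → I.satS s κ

/-! ### Non-annotated (plain) semantics -/

structure PInterp (Δ : Type) where
  dom : Set Δ
  dom_nonempty : dom.Nonempty
  indiv : ℕ → Δ
  indiv_mem : ∀ a, indiv a ∈ dom
  conc : ℕ → Set Δ
  conc_mem : ∀ A d, d ∈ conc A → d ∈ dom
  role : ℕ → Set (Δ × Δ)
  role_mem : ∀ R p, p ∈ role R → p.1 ∈ dom ∧ p.2 ∈ dom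

def DLRole.pinterp (I : PInterp Δ) : DLRole → Set (Δ × Δ)
  | .name R => I.role R
  | .inv R => {p | (p.2, p.1) ∈ I.role R}

def DLConcept.pinterp (I : PInterp Δ) : DLConcept → Set Δ
  | .top => I.dom
  | .bot => ∅
  | .atom A => I.conc A
  | .inter C D => DLConcept.pinterp I C ∩ DLConcept.pinterp I D
  | .exis P C => {d | ∃ e, (d, e) ∈ DLRole.pinterp I P ∧ e ∈ DLConcept.pinterp I C}

def PInterp.satA (I : PInterp Δ) : DLAxiom → Prop
  | .cassert A a => I.indiv a ∈ I.conc A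
  | .rassert R a b => (I.indiv a, I.indiv b) ∈ I.role R
  | .roleInc P Q => ∀ p ∈ P.pinterp I, p ∈ Q.pinterp I
  | .roleDisj P Q => ∀ p, p ∈ P.pinterp I → p ∈ Q.pinterp I → False
  | .gci C D => C.pinterp I ⊆ D.pinterp I

def PInterp.tval (I : PInterp Δ) (π : ℕ → Δ) : DLTerm → Δ
  | .var v => π v
  | .ind a => I.indiv a

def QAtom.pholds (I : PInterp Δ) (π : ℕ → Δ) : QAtom → Prop
  | .top t => I.tval π t ∈ I.dom
  | .conc A t => I.tval π t ∈ I.conc A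
  | .role R t t' => (I.tval π t, I.tval π t') ∈ I.role R

def PInterp.satQ (I : PInterp Δ) (q : BCQ) : Prop :=
  ∃ π : ℕ → Δ, (∀ v, π v ∈ I.dom) ∧ ∀ a ∈ q, QAtom.pholds I π a

def PInterp.satS (I : PInterp Δ) : DLStmt → Prop
  | .ax α => I.satA α
  | .query q => I.satQ q

def isPModel (I : PInterp Δ) (O : Finset DLAxiom) : Prop := ∀ α ∈ O, I.satA α

def PSat (O : Finset DLAxiom) : Prop := ∃ (Δ : Type) (I : PInterp Δ), isPModel I O

def PEntails (O : Finset DLAxiom) (s : DLStmt) : Prop :=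
  ∀ (Δ : Type) (I : PInterp Δ), isPModel I O → I.satS s

/-- A concept is satisfiable w.r.t. O if it has a nonempty extension in some model of O. -/
def CSat (O : Finset DLAxiom) (C : DLConcept) : Prop :=
  ∃ (Δ : Type) (I : PInterp Δ), isPModel I O ∧ (C.pinterp I).Nonempty

/-- A role is satisfiable w.r.t. O if it has a nonempty extension in some model of O. -/
def RSat (O : Finset DLAxiom) (P : DLRole) : Prop :=
  ∃ (Δ : Type) (I : PInterp Δ), isPModel I O ∧ (P.pinterp I).Nonempty

/-- The plain interpretation obtained from an annotated one by dropping annotations. -/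
def Interp.forget (I : Interp Δ K) : PInterp Δ where
  dom := I.dom
  dom_nonempty := I.dom_nonempty
  indiv := I.indiv
  indiv_mem := I.indiv_mem
  conc A := {d | ∃ κ, (d, κ) ∈ I.conc A}
  conc_mem := fun A d hd => by obtain ⟨κ, hκ⟩ := hd; exact I.conc_mem A _ hκ
  role R := {p | ∃ κ, (p.1, p.2, κ) ∈ I.role R}
  role_mem := fun R p hp => by obtain ⟨κ, hκ⟩ := hp; exact I.role_mem R _ hκ

/-! ### ω-continuous commutative semirings and provenance -/

/-- The canonical preorder of a semiring: a ≤ b iff a ⊕ c = b for some c. -/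
def canLE [Add K] (a b : K) : Prop := ∃ c, a + c = b

/-- The set of all sums of finite subsets of `S`. -/
def finSubsums [AddCommMonoid K] (S : Set K) : Set K :=
  {x | ∃ F : Finset K, ↑F ⊆ S ∧ F.sum id = x}

/-- `u` is a least upper bound of `S` w.r.t. the canonical preorder. -/
def IsSupOf [Add K] (S : Set K) (u : K) : Prop :=
  (∀ a ∈ S, canLE a u) ∧ ∀ v, (∀ a ∈ S, canLE a v) → canLE u v

/-- ω-continuous commutative semirings: the canonical preorder is a partial order,
ω-chains have least upper bounds preserved by ⊕ and ⊗, and possibly infinite sums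
are defined as suprema of finite subsums. -/
class OmegaCS (K : Type) extends CommSemiring K where
  canLE_antisymm : ∀ a b : K, canLE a b → canLE b a → a = b
  csup : (ℕ → K) → K
  csup_isSup : ∀ f : ℕ → K, (∀ n, canLE (f n) (f (n + 1))) → IsSupOf (Set.range f) (csup f)
  add_csup : ∀ f : ℕ → K, (∀ n, canLE (f n) (f (n + 1))) →
      ∀ a : K, a + csup f = csup fun n => a + f n
  mul_csup : ∀ f : ℕ → K, (∀ n, canLE (f n) (f (n + 1))) →
      ∀ a : K, a * csup f = csup fun n => a * f n
  setSum : Set K → K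
  setSum_isSup : ∀ S : Set K, IsSupOf (finSubsums S) (setSum S)

/-- The provenance of a statement w.r.t. a set of annotated axioms: the (possibly
infinite) sum of all κ such that (s, κ) is entailed. -/
def prov [OmegaCS K] (Ω : Set (DLAxiom × K)) (s : DLStmt) : K :=
  OmegaCS.setSum {κ | Entails Ω s κ}

/-! ### Instance queries -/

/-- `qCt C t n` is the (body of) the instance query for the concept `C` with head
term `t`, using fresh variables starting from `n`; returns the query together with
the next fresh variable index. -/
def qCt : DLConcept → DLTerm → ℕ → BCQ × ℕ
  | .top, t, n => ([QAtom.top t], n)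
  | .bot, t, n => ([QAtom.top t], n)
  | .atom A, t, n => ([QAtom.conc A t], n)
  | .inter C D, t, n =>
      let r₁ := qCt C t n
      let r₂ := qCt D t r₁.2
      (r₁.1 ++ r₂.1, r₂.2)
  | .exis (.name R) C, t, n =>
      let r := qCt C (.var n) (n + 1)
      (QAtom.role R t (.var n) :: r.1, r.2)
  | .exis (.inv R) C, t, n =>
      let r := qCt C (.var n) (n + 1)
      (QAtom.role R (.var n) t :: r.1, r.2)

/-- The instance query q_C(a) for an individual name a. -/
def qCa (C : DLConcept) (a : ℕ) : BCQ := (qCt C (DLTerm.ind a) 0).1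

/-! ### Database matches -/

def tvalN (σ : ℕ → ℕ) : DLTerm → ℕ
  | .var v => σ v
  | .ind a => a

def QAtom.dbHolds (O : Finset DLAxiom) (σ : ℕ → ℕ) : QAtom → Prop
  | .top _ => True
  | .conc A t => DLAxiom.cassert A (tvalN σ t) ∈ O
  | .role R t t' => DLAxiom.rassert R (tvalN σ t) (tvalN σ t') ∈ O

/-- A database match of a BCQ in a set of assertions. -/
def isDBMatch (O : Finset DLAxiom) (σ : ℕ → ℕ) (q : BCQ) : Prop :=
  ∀ a ∈ q, QAtom.dbHolds O σ a

def QAtom.dbVal [CommSemiring K] (lam : DLAxiom → K) (σ : ℕ → ℕ) : QAtom → K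
  | .top _ => 1
  | .conc A t => lam (DLAxiom.cassert A (tvalN σ t))
  | .role R t t' => lam (DLAxiom.rassert R (tvalN σ t) (tvalN σ t'))

/-- The ⊗-product, over the atoms of `q`, of the annotations of the matched facts. -/
def matchVal [CommSemiring K] (lam : DLAxiom → K) (σ : ℕ → ℕ) (q : BCQ) : K :=
  (q.map (QAtom.dbVal lam σ)).prod

/-! ### Homomorphisms and canonical models -/

/-- Homomorphism between 𝕂-annotated interpretations. -/
def IsHom [CommSemiring K] (Ic : Interp Δ K) (I : Interp Δ' K) (g : Δ → Δ') : Prop :=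
  Set.MapsTo g Ic.dom I.dom ∧ (∀ a, g (Ic.indiv a) = I.indiv a) ∧
  (∀ A d κ, (d, κ) ∈ Ic.conc A → (g d, κ) ∈ I.conc A) ∧
  (∀ R d e κ, (d, e, κ) ∈ Ic.role R → (g d, g e, κ) ∈ I.role R)

/-- Domain of canonical models: individual names (inl) plus fresh elements (inr). -/
abbrev CD : Type := ℕ ⊕ ℕ

def baseConc (Ω : Set (DLAxiom × K)) (A : ℕ) : Set (CD × K) :=
  {p | ∃ a κ, (DLAxiom.cassert A a, κ) ∈ Ω ∧ p = (Sum.inl a, κ)}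

def baseRole (Ω : Set (DLAxiom × K)) (R : ℕ) : Set (CD × CD × K) :=
  {p | ∃ a b κ, (DLAxiom.rassert R a b, κ) ∈ Ω ∧ p = (Sum.inl a, Sum.inl b, κ)}

/-- The initial interpretation I₀ of the canonical model construction. -/
def InitCan (Ω : Set (DLAxiom × K)) (I : Interp CD K) : Prop :=
  I.dom = Set.range (Sum.inl : ℕ → CD) ∧ I.indiv = Sum.inl ∧
  (∀ A, I.conc A = baseConc Ω A) ∧ (∀ R, I.role R = baseRole Ω R)

/-- Where and how a tuple is inserted for the role `P`: the underlying role name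
and the (suitably oriented) tuple. -/
def insRole (P : DLRole) (d e : CD) (κ : K) : ℕ × (CD × CD × K) :=
  match P with
  | .name R => (R, (d, e, κ))
  | .inv R => (R, (e, d, κ))

/-- One application of a rule of the canonical model construction. -/
def StepCan [CommSemiring K] (Ω : Set (DLAxiom × K)) (I J : Interp CD K) : Prop :=
  (∃ P Q κ d e κ', (DLAxiom.roleInc P Q, κ) ∈ Ω ∧ (d, e, κ') ∈ DLRole.interp I P ∧
     J.dom = I.dom ∧ J.indiv = I.indiv ∧ (∀ A, J.conc A = I.conc A) ∧
     (∀ S, S ≠ (insRole Q d e (κ * κ')).1 → J.role S = I.role S) ∧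
     J.role (insRole Q d e (κ * κ')).1 =
       insert (insRole Q d e (κ * κ')).2 (I.role (insRole Q d e (κ * κ')).1)) ∨
  (∃ C A κ d κ', (DLAxiom.gci C (DLConcept.atom A), κ) ∈ Ω ∧ (d, κ') ∈ DLConcept.interp I C ∧
     J.dom = I.dom ∧ J.indiv = I.indiv ∧ (∀ R, J.role R = I.role R) ∧
     (∀ B, B ≠ A → J.conc B = I.conc B) ∧ J.conc A = insert (d, κ * κ') (I.conc A)) ∨
  (∃ C P κ d κ' df, (DLAxiom.gci C (DLConcept.exis P DLConcept.top), κ) ∈ Ω ∧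
     (d, κ') ∈ DLConcept.interp I C ∧ df ∉ I.dom ∧
     J.dom = insert df I.dom ∧ J.indiv = I.indiv ∧ (∀ A, J.conc A = I.conc A) ∧
     (∀ S, S ≠ (insRole P d df (κ * κ')).1 → J.role S = I.role S) ∧
     J.role (insRole P d df (κ * κ')).1 =
       insert (insRole P d df (κ * κ')).2 (I.role (insRole P d df (κ * κ')).1))

/-- Fairness: every applicable rule instance has eventually been applied,
i.e. the limit is closed under the rules. -/
def ClosedCan [CommSemiring K] (Ω : Set (DLAxiom × K)) (I : Interp CD K) : Prop :=
  (∀ P Q κ, (DLAxiom.roleInc P Q, κ) ∈ Ω →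
      ∀ d e κ', (d, e, κ') ∈ DLRole.interp I P → (d, e, κ * κ') ∈ DLRole.interp I Q) ∧
  (∀ C A κ, (DLAxiom.gci C (DLConcept.atom A), κ) ∈ Ω →
      ∀ d κ', (d, κ') ∈ DLConcept.interp I C → (d, κ * κ') ∈ I.conc A) ∧
  (∀ C P κ, (DLAxiom.gci C (DLConcept.exis P DLConcept.top), κ) ∈ Ω →
      ∀ d κ', (d, κ') ∈ DLConcept.interp I C → ∃ e, (d, e, κ * κ') ∈ DLRole.interp I P)

/-- `I` is the union of the increasing sequence `Iseq`. -/
def IsLimitOf (Iseq : ℕ → Interp CD K) (I : Interp CD K) : Prop :=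
  I.dom = (⋃ n, (Iseq n).dom) ∧ I.indiv = (Iseq 0).indiv ∧
  (∀ A, I.conc A = ⋃ n, (Iseq n).conc A) ∧ (∀ R, I.role R = ⋃ n, (Iseq n).role R)

/-- `I` is a canonical model of the annotated ontology `Ω`. -/
def IsCanMod [CommSemiring K] (Ω : Set (DLAxiom × K)) (I : Interp CD K) : Prop :=
  ∃ Iseq : ℕ → Interp CD K, InitCan Ω (Iseq 0) ∧
    (∀ n, Iseq (n + 1) = Iseq n ∨ StepCan Ω (Iseq n) (Iseq (n + 1))) ∧
    IsLimitOf Iseq I ∧ ClosedCan Ω I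

/-- The initial interpretation of the canonical model construction for a basic
concept `C` annotated with `κ`, with distinguished fresh element `dC`. -/
def InitCanC [CommSemiring K] (Ω : Set (DLAxiom × K)) (C : DLConcept) (κ : K)
    (dC : CD) (I : Interp CD K) : Prop :=
  I.indiv = Sum.inl ∧ dC ∉ Set.range (Sum.inl : ℕ → CD) ∧
  match C with
  | .atom A =>
      I.dom = insert dC (Set.range (Sum.inl : ℕ → CD)) ∧
      (∀ B, B ≠ A → I.conc B = baseConc Ω B) ∧
      I.conc A = insert (dC, κ) (baseConc Ω A) ∧
      (∀ R, I.role R = baseRole Ω R)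
  | .exis P .top =>
      ∃ df, df ∉ Set.range (Sum.inl : ℕ → CD) ∧ df ≠ dC ∧
        I.dom = insert dC (insert df (Set.range (Sum.inl : ℕ → CD))) ∧
        (∀ B, I.conc B = baseConc Ω B) ∧
        (∀ S, S ≠ (insRole P dC df κ).1 → I.role S = baseRole Ω S) ∧
        I.role (insRole P dC df κ).1 =
          insert (insRole P dC df κ).2 (baseRole Ω (insRole P dC df κ).1)
  | _ => False

/-- `I` is a canonical model of the basic concept `C`, annotation `κ` and `Ω`. -/
def IsCanModC [CommSemiring K] (Ω : Set (DLAxiom × K)) (C : DLConcept) (κ : K)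
    (dC : CD) (I : Interp CD K) : Prop :=
  ∃ Iseq : ℕ → Interp CD K, InitCanC Ω C κ dC (Iseq 0) ∧
    (∀ n, Iseq (n + 1) = Iseq n ∨ StepCan Ω (Iseq n) (Iseq (n + 1))) ∧
    IsLimitOf Iseq I ∧ ClosedCan Ω I


/-- Extending roles by one tuple preserves the homomorphism condition on roles. -/
theorem role_map_of_insert {I : Interp Δ K} {g : CD → Δ} {r₀ r : ℕ → Set (CD × CD × K)}
    {P : DLRole} {d e : CD} {κ : K}
    (hne : ∀ S, S ≠ (insRole P d e κ).1 → r S = r₀ S)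
    (heq : r (insRole P d e κ).1 = insert (insRole P d e κ).2 (r₀ (insRole P d e κ).1))
    (h₀ : ∀ R x y k, (x, y, k) ∈ r₀ R → (g x, g y, k) ∈ I.role R)
    (hP : (g d, g e, κ) ∈ P.interp I) :
    ∀ R x y k, (x, y, k) ∈ r R → (g x, g y, k) ∈ I.role R := by
  intro R x y k h
  by_cases hR : R = (insRole P d e κ).1
  · subst hR
    rw [heq] at h
    rcases h with h | h
    · cases P <;>
      · simp only [insRole, Prod.mk.injEq] at h
        obtain ⟨rfl, rfl, rfl⟩ := h
        exact hP
    · exact h₀ _ _ _ _ h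
  · rw [hne R hR] at h
    exact h₀ _ _ _ _ h

/-- Extending a concept name by one pair preserves the homomorphism condition on concepts. -/
theorem conc_map_of_insert {I : Interp Δ K} {g : CD → Δ} {c₀ c : ℕ → Set (CD × K)}
    {A : ℕ} {d : CD} {κ : K}
    (hne : ∀ B, B ≠ A → c B = c₀ B) (heq : c A = insert (d, κ) (c₀ A))
    (h₀ : ∀ B x k, (x, k) ∈ c₀ B → (g x, k) ∈ I.conc B)
    (hA : (g d, κ) ∈ I.conc A) :
    ∀ B x k, (x, k) ∈ c B → (g x, k) ∈ I.conc B := by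
  intro B x k h
  by_cases hB : B = A
  · subst hB
    rw [heq] at h
    rcases h with h | h
    · obtain ⟨rfl, rfl⟩ := Prod.mk.inj h
      exact hA
    · exact h₀ _ _ _ h
  · rw [hne B hB] at h
    exact h₀ _ _ _ h

namespace IsHom

variable [CommSemiring K] {J : Interp Δ K} {I : Interp Δ' K} {g : Δ → Δ'}

theorem role_interp (hg : IsHom J I g) {P : DLRole} {d e : Δ} {κ : K}
    (h : (d, e, κ) ∈ P.interp J) : (g d, g e, κ) ∈ P.interp I := by
  cases P <;> exact hg.2.2.2 _ _ _ _ h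

theorem concept_interp (hg : IsHom J I g) {C : DLConcept} {d : Δ} {κ : K}
    (h : (d, κ) ∈ C.interp J) : (g d, κ) ∈ C.interp I := by
  induction C generalizing d κ with
  | top => exact ⟨hg.1 h.1, h.2⟩
  | bot => exact h
  | atom A => exact hg.2.2.1 _ _ _ h
  | inter C D ihC ihD =>
    obtain ⟨x, κ₁, κ₂, h₁, h₂, hx⟩ := h
    obtain ⟨rfl, rfl⟩ := Prod.mk.inj hx
    exact ⟨_, _, _, ihC h₁, ihD h₂, rfl⟩
  | exis P C ih =>
    obtain ⟨x, e, κ₁, κ₂, h₁, h₂, hx⟩ := h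
    obtain ⟨rfl, rfl⟩ := Prod.mk.inj hx
    exact ⟨_, _, _, _, hg.role_interp h₁, ih h₂, rfl⟩

/-- Being a homomorphism depends only on the values on the domain. -/
theorem congr {g' : Δ → Δ'} (hg : IsHom J I g) (h : Set.EqOn g' g J.dom) : IsHom J I g' := by
  refine ⟨hg.1.congr h.symm, fun a => ?_, fun A d κ hd => ?_, fun R d e κ hde => ?_⟩
  · rw [h (J.indiv_mem a), hg.2.1]
  · rw [h (J.conc_mem A _ hd)]
    exact hg.2.2.1 _ _ _ hd
  · rw [h (J.role_mem R _ hde).1, h (J.role_mem R _ hde).2]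
    exact hg.2.2.2 _ _ _ _ hde

end IsHom

/-- A pair in the extension of `∃P` is witnessed by a `P`-edge with the same annotation. -/
theorem exists_role_of_mem_exis_top [CommSemiring K] {I : Interp Δ K} {P : DLRole} {d : Δ} {κ : K}
    (h : (d, κ) ∈ (DLConcept.exis P .top).interp I) :
    ∃ e ∈ I.dom, (d, e, κ) ∈ P.interp I := by
  obtain ⟨x, e, κ₁, κ₂, h₁, ⟨he, hκ⟩, hx⟩ := h
  obtain ⟨rfl, rfl⟩ := Prod.mk.inj hx
  obtain rfl : κ₂ = 1 := hκ
  exact ⟨e, he, by simpa using h₁⟩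

theorem mem_dom_of_mem_interp [CommSemiring K] {I : Interp Δ K} {C : DLConcept}
    {d : Δ} {κ : K} (h : (d, κ) ∈ C.interp I) : d ∈ I.dom := by
  induction C generalizing d κ with
  | top => exact h.1
  | bot => exact h.elim
  | atom A => exact I.conc_mem _ _ h
  | inter C D ihC ihD =>
    obtain ⟨x, κ₁, κ₂, h₁, -, hx⟩ := h
    obtain ⟨rfl, rfl⟩ := Prod.mk.inj hx
    exact ihC h₁
  | exis P C ih =>
    obtain ⟨x, e, κ₁, κ₂, h₁, -, hx⟩ := h
    obtain ⟨rfl, rfl⟩ := Prod.mk.inj hx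
    cases P
    · exact (I.role_mem _ _ h₁).1
    · exact (I.role_mem _ _ h₁).2

/-- A homomorphism into a model extends along one rule application. -/
theorem IsHom.extend_step [CommSemiring K] {Ω : Set (DLAxiom × K)} {I : Interp Δ K}
    (hI : isModel I Ω) {J J' : Interp CD K} {g : CD → Δ} (hg : IsHom J I g)
    (hstep : J' = J ∨ StepCan Ω J J') :
    ∃ g', IsHom J' I g' ∧ J.dom ⊆ J'.dom ∧ Set.EqOn g' g J.dom := by
  rcases hstep with rfl | ⟨P, Q, κ, d, e, κ', hax, hde, hdom, hind, hconc, hne, heq⟩ |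
    ⟨C, A, κ, d, κ', hax, hd, hdom, hind, hrole, hne, heq⟩ |
    ⟨C, P, κ, d, κ', df, hax, hd, hdf, hdom, hind, hconc, hne, heq⟩
  · exact ⟨g, hg, subset_rfl, fun _ _ => rfl⟩
  · refine ⟨g, ⟨hdom ▸ hg.1, hind ▸ hg.2.1, fun A => hconc A ▸ hg.2.2.1 A, ?_⟩, hdom.ge,
      fun _ _ => rfl⟩
    exact role_map_of_insert hne heq hg.2.2.2 (hI _ hax _ _ _ (hg.role_interp hde))
  · refine ⟨g, ⟨hdom ▸ hg.1, hind ▸ hg.2.1, ?_, fun R => hrole R ▸ hg.2.2.2 R⟩, hdom.ge,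
      fun _ _ => rfl⟩
    exact conc_map_of_insert hne heq hg.2.2.1 (hI _ hax _ _ (hg.concept_interp hd))
  · obtain ⟨e, he, hde⟩ := exists_role_of_mem_exis_top (hI _ hax _ _ (hg.concept_interp hd))
    have hEq : Set.EqOn (Function.update g df e) g J.dom := fun x hx =>
      Function.update_of_ne (ne_of_mem_of_not_mem hx hdf) _ _
    have hg' := hg.congr hEq
    refine ⟨Function.update g df e, ⟨?_, hind ▸ hg'.2.1, fun A => hconc A ▸ hg'.2.2.1 A, ?_⟩,
      hdom ▸ Set.subset_insert _ _, hEq⟩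
    · rw [hdom]
      rintro x (rfl | hx)
      · simpa using he
      · exact hg'.1 hx
    · refine role_map_of_insert hne heq hg'.2.2.2 ?_
      rwa [hEq (mem_dom_of_mem_interp hd), Function.update_self]

theorem map_baseConc [CommSemiring K] {Ω : Set (DLAxiom × K)} {I : Interp Δ K} (hI : isModel I Ω)
    {g : CD → Δ} (hg : ∀ a, g (Sum.inl a) = I.indiv a) (A : ℕ) (x : CD) (k : K)
    (h : (x, k) ∈ baseConc Ω A) : (g x, k) ∈ I.conc A := by
  obtain ⟨a, κ, hax, hx⟩ := h
  obtain ⟨rfl, rfl⟩ := Prod.mk.inj hx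
  rw [hg]
  exact hI _ hax

theorem map_baseRole [CommSemiring K] {Ω : Set (DLAxiom × K)} {I : Interp Δ K} (hI : isModel I Ω)
    {g : CD → Δ} (hg : ∀ a, g (Sum.inl a) = I.indiv a) (R : ℕ) (x y : CD) (k : K)
    (h : (x, y, k) ∈ baseRole Ω R) : (g x, g y, k) ∈ I.role R := by
  obtain ⟨a, b, κ, hax, hx⟩ := h
  simp only [Prod.mk.injEq] at hx
  obtain ⟨rfl, rfl, rfl⟩ := hx
  rw [hg, hg]
  exact hI _ hax

/-- The initial interpretation for a basic concept maps into any model realizing the concept. -/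
theorem InitCanC.exists_isHom [CommSemiring K] {Ω : Set (DLAxiom × K)} {C : DLConcept}
    (hC : C.isBasic) {κ : K} {dC : CD} {J : Interp CD K} (hJ : InitCanC Ω C κ dC J)
    {I : Interp Δ K} (hI : isModel I Ω) {d : Δ} (hd : (d, κ) ∈ C.interp I) :
    ∃ g, IsHom J I g ∧ dC ∈ J.dom ∧ g dC = d := by
  have hdI := mem_dom_of_mem_interp hd
  rcases hC with ⟨A, rfl⟩ | ⟨P, rfl⟩
  · obtain ⟨hind, hdC, hdom, hne, heq, hrole⟩ := hJ
    have hg : ∀ a, Function.update (Sum.elim I.indiv fun _ => d) dC d (Sum.inl a) = I.indiv a :=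
      fun a => Function.update_of_ne (fun h => hdC ⟨a, h⟩) _ _
    refine ⟨_, ⟨?_, fun a => by rw [hind]; exact hg a, ?_, fun R => ?_⟩,
      hdom ▸ Set.mem_insert _ _, Function.update_self _ _ _⟩
    · rw [hdom]
      rintro x (rfl | ⟨a, rfl⟩)
      · rwa [Function.update_self]
      · rw [hg]
        exact I.indiv_mem a
    · refine conc_map_of_insert hne heq (map_baseConc hI hg) ?_
      rwa [Function.update_self]
    · rw [hrole]
      exact map_baseRole hI hg R
  · obtain ⟨hind, hdC, df, hdf, hdfC, hdom, hconc, hne, heq⟩ := hJ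
    obtain ⟨e, he, hde⟩ := exists_role_of_mem_exis_top hd
    set g := Function.update (Function.update (Sum.elim I.indiv fun _ => d) df e) dC d with hgdef
    have hg : ∀ a, g (Sum.inl a) = I.indiv a := fun a => by
      rw [hgdef, Function.update_of_ne fun h => hdC ⟨a, h⟩,
        Function.update_of_ne fun h => hdf ⟨a, h⟩, Sum.elim_inl]
    have hgC : g dC = d := Function.update_self _ _ _
    have hgf : g df = e := by rw [hgdef, Function.update_of_ne hdfC, Function.update_self]
    refine ⟨g, ⟨?_, fun a => by rw [hind]; exact hg a, fun A => ?_, ?_⟩,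
      hdom ▸ Set.mem_insert _ _, hgC⟩
    · rw [hdom]
      rintro x (rfl | rfl | ⟨a, rfl⟩)
      · rwa [hgC]
      · rwa [hgf]
      · rw [hg]
        exact I.indiv_mem a
    · rw [hconc]
      exact map_baseConc hI hg A
    · refine role_map_of_insert hne heq (map_baseRole hI hg) ?_
      rwa [hgC, hgf]

/-- A compatible sequence of homomorphisms from an increasing sequence of interpretations induces
a homomorphism from its limit. -/
theorem IsLimitOf.exists_isHom [CommSemiring K] {Iseq : ℕ → Interp CD K} {J : Interp CD K}
    (hJ : IsLimitOf Iseq J) {I : Interp Δ K} {G : ℕ → CD → Δ}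
    (hG : ∀ n, IsHom (Iseq n) I (G n)) (hsub : ∀ n, (Iseq n).dom ⊆ (Iseq (n + 1)).dom)
    (hEq : ∀ n, Set.EqOn (G (n + 1)) (G n) (Iseq n).dom) :
    ∃ g, IsHom J I g ∧ ∀ n, Set.EqOn g (G n) (Iseq n).dom := by
  classical
  have hmono : Monotone fun n => (Iseq n).dom := monotone_nat_of_le_succ hsub
  have hle : ∀ m n, m ≤ n → Set.EqOn (G n) (G m) (Iseq m).dom := by
    intro m n hmn
    induction n, hmn using Nat.le_induction with
    | base => exact fun _ _ => rfl
    | succ n hmn ih => exact ((hEq n).mono (hmono hmn)).trans ih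
  let g : CD → Δ := fun x => if h : ∃ n, x ∈ (Iseq n).dom then G (Nat.find h) x else G 0 x
  have hg : ∀ n, Set.EqOn g (G n) (Iseq n).dom := by
    intro n x hx
    have h : ∃ n, x ∈ (Iseq n).dom := ⟨n, hx⟩
    simp only [g, dif_pos h]
    exact (hle _ _ (Nat.find_min' h hx) (Nat.find_spec h)).symm
  have hom n : IsHom (Iseq n) I g := (hG n).congr (hg n)
  obtain ⟨hdom, hind, hconc, hrole⟩ := hJ
  refine ⟨g, ⟨fun x hx => ?_, hind ▸ (hom 0).2.1, fun A x k hx => ?_, fun R x y k hx => ?_⟩, hg⟩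
  · rw [hdom] at hx
    obtain ⟨n, hn⟩ := Set.mem_iUnion.1 hx
    exact (hom n).1 hn
  · rw [hconc] at hx
    obtain ⟨n, hn⟩ := Set.mem_iUnion.1 hx
    exact (hom n).2.2.1 _ _ _ hn
  · rw [hrole] at hx
    obtain ⟨n, hn⟩ := Set.mem_iUnion.1 hx
    exact (hom n).2.2.2 _ _ _ _ hn

/-- If (d,κ) belongs to the extension of a basic concept C in a
model I of a satisfiable annotated ontology, then there is a homomorphism from any
canonical model of C, κ and the ontology into I mapping d_C to d. -/
theorem statement6 {K : Type} [CommSemiring K]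
    (O : Finset DLAxiom) (lam : DLAxiom → K)
    (hwf : ∀ α ∈ O, α.wf) (hnz : ∀ α ∈ O, lam α ≠ 0)
    (hsat : AnnSat (toAnn O lam))
    (C : DLConcept) (hC : C.isBasic) (κ : K)
    (Δ : Type) (I : Interp Δ K) (hI : isModel I (toAnn O lam))
    (d : Δ) (hd : (d, κ) ∈ C.interp I) :
    ∀ (dC : CD) (Ican : Interp CD K), IsCanModC (toAnn O lam) C κ dC Ican →
      ∃ g : CD → Δ, IsHom Ican I g ∧ g dC = d := by
  rintro dC Ican ⟨Iseq, hinit, hstep, hlim, -⟩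
  obtain ⟨g₀, hg₀, hdC, hgd⟩ := hinit.exists_isHom hC hI hd
  choose next hnext hsub hEq using
    fun n (g : {g // IsHom (Iseq n) I g}) => g.2.extend_step hI (hstep n)
  let G : ∀ n, {g // IsHom (Iseq n) I g} :=
    Nat.rec ⟨g₀, hg₀⟩ fun n g => ⟨next n g, hnext n g⟩
  obtain ⟨g, hg, hgG⟩ := hlim.exists_isHom (fun n => (G n).2) (fun n => hsub n (G n))
    (fun n => hEq n (G n))
  exact ⟨g, hg, (hgG 0 hdC).trans hgd⟩

end DLProv
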